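/- Let α be a CNF formula over variables x_1,…,x_{n−1}, and define the Boolean classifier ρ over {0,1}^n by ρ(x) = 1 iff α(x_1,…,x_{n−1}) = 1 or x_1 = x_2 = … = x_n = 1. Then α is unsatisfiable if and only if the feature x_n is mandatory for the class of positive instances of ρ, i.e., if and only if every x ∈ {0,1}^n with ρ(x) = 1 satisfies x_n = 1. -/

import Mathlib

/-- A literal is a variable together with a polarity (`true` for `x_i`,
`false` for `¬x_i`); a clause is a disjunction of literals. -/
abbrev Clause (n : ℕ) := List (Fin n × Bool)

/-- A CNF formula is a conjunction of clauses. -/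
abbrev CNF (n : ℕ) := List (Clause n)

/-- A clause evaluates to `true` on `x` iff some of its literals is satisfied by `x`. -/
def Clause.eval {n : ℕ} (δ : Clause n) (x : Fin n → Bool) : Bool :=
  δ.any fun l => x l.1 == l.2

/-- A CNF formula evaluates to `true` on `x` iff all of its clauses do. -/
def CNF.eval {n : ℕ} (α : CNF n) (x : Fin n → Bool) : Bool :=
  α.all fun δ => Clause.eval δ x

/-- A CNF formula is satisfiable if some instance evaluates it to `true`. -/
def CNF.Satisfiable {n : ℕ} (α : CNF n) : Prop := ∃ x, CNF.eval α x = true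

theorem stmt4 (m : ℕ) (α : CNF m)
    (ρ : (Fin (m + 1) → Bool) → Bool)
    (hρ : ∀ x, ρ x =
      (CNF.eval α (fun i => x i.castSucc) || decide (∀ i, x i = true))) :
    ¬α.Satisfiable ↔ ∀ x, ρ x = true → x (Fin.last m) = true := by
  constructor
  · intro hα x hx
    rw [hρ, Bool.or_eq_true, decide_eq_true_eq] at hx
    exact hx.elim (fun h => absurd ⟨_, h⟩ hα) fun h => h _
  · rintro h ⟨x, hx⟩
    have hlast := h (Fin.snoc (α := fun _ => Bool) x false) (by simp [hρ, hx])
    simp at hlast
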